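/- Let (S_i, σ_{i,i+1}) and (T_i, τ_{i,i+1}) be inductive sequences of Cu-semigroups with inductive limits (S,(σ_{i∞})) and (T,(τ_{i∞})) in Cu, each S_i carrying a uniform basis (M_n, ε_n)_n. Suppose there are Cu-morphisms c_i : S_i → T_i forming a one-sided approximate intertwining, i.e. there is a strictly increasing sequence (n_i) of natural numbers with: (i) σ_{ij}(M_{n_j}) ⊆ M_{n_j} for all i ≤ j; (ii) c_{i+1} ∘ σ_{i,i+1} ≈_{M_{n_i}} τ_{i,i+1} ∘ c_i for all i. Then for every i and every s ∈ ∪_l M_l ⊆ (S_i)_≪, writing s_l := min{l | s ∈ M_l}, the sequence (τ_{j+1,∞}(c_{j+1}(σ_{i,j+1}(ε_{n_j}(s)))))_{j > max(i, s_l)} is ≪-increasing in T, and the map γ_i : ∪_l M_l → T sending s to its supremum is additive, order-preserving and sends 0 to 0 (a PoM-morphism). -/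

import Mathlib

open Set

/-- `x` is way-below `y`. -/
def WayBelow {S : Type*} [Preorder S] (x y : S) : Prop :=
  ∀ z : ℕ → S, Monotone z → ∀ w : S, IsLUB (Set.range z) w → y ≤ w → ∃ k, x ≤ z k

/-- The set `S_≪` of elements way-below something. -/
def wbSet (S : Type*) [Preorder S] : Set S := {s | ∃ t, WayBelow s t}

/-- `S` is an abstract Cuntz semigroup. -/
structure IsCu (S : Type*) [AddCommMonoid S] [PartialOrder S] [IsOrderedAddMonoid S] : Prop where
  zero_le : ∀ x : S, 0 ≤ x
  O1 : ∀ z : ℕ → S, Monotone z → ∃ w, IsLUB (Set.range z) w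
  O2 : ∀ x : S, ∃ z : ℕ → S, (∀ n, WayBelow (z n) (z (n + 1))) ∧ IsLUB (Set.range z) x
  O3 : ∀ x' x y' y : S, WayBelow x' x → WayBelow y' y → WayBelow (x' + y') (x + y)
  O4 : ∀ x y : ℕ → S, Monotone x → Monotone y → ∀ a b : S, IsLUB (Set.range x) a →
    IsLUB (Set.range y) b → IsLUB (Set.range fun n => x n + y n) (a + b)

/-- Generalized Cu-morphism. -/
structure IsGenCuMorphism {S T : Type*} [AddCommMonoid S] [PartialOrder S] [IsOrderedAddMonoid S]
    [AddCommMonoid T] [PartialOrder T] [IsOrderedAddMonoid T]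
    (f : S → T) : Prop where
  map_zero : f 0 = 0
  map_add : ∀ x y, f (x + y) = f x + f y
  mono : Monotone f
  map_sup : ∀ (z : ℕ → S) (w : S), Monotone z → IsLUB (Set.range z) w →
    IsLUB (Set.range fun n => f (z n)) (f w)

/-- Cu-morphism. -/
structure IsCuMorphism {S T : Type*} [AddCommMonoid S] [PartialOrder S] [IsOrderedAddMonoid S]
    [AddCommMonoid T] [PartialOrder T] [IsOrderedAddMonoid T]
    (f : S → T) extends IsGenCuMorphism f : Prop where
  map_wayBelow : ∀ x y, WayBelow x y → WayBelow (f x) (f y)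

/-- A uniform basis of a Cu-semigroup. -/
structure UniformBasis (S : Type*) [AddCommMonoid S] [PartialOrder S] [IsOrderedAddMonoid S] where
  M : ℕ → Set S
  eps : ℕ → S → S
  M_zero : M 0 = {0}
  zero_mem : ∀ n, (0 : S) ∈ M n
  add_mem : ∀ n, ∀ x ∈ M n, ∀ y ∈ M n, x + y ∈ M n
  M_subset : ∀ n, M n ⊆ wbSet S
  eps_mem : ∀ n, ∀ s ∈ wbSet S, eps n s ∈ M n
  eps_mono : ∀ n, ∀ s ∈ wbSet S, ∀ t ∈ wbSet S, s ≤ t → eps n s ≤ eps n t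
  eps_superadd : ∀ n, ∀ s ∈ wbSet S, ∀ t ∈ wbSet S, eps n s + eps n t ≤ eps n (s + t)
  U1 : ∀ n, M n ⊆ M (n + 1)
  U2 : ∀ n s t, (∃ l, l + 1 < n ∧ s ∈ M l) → (∃ l, l + 1 < n ∧ t ∈ M l) →
    eps n (s + t) = eps n s + eps n t
  U3_mono : ∀ s ∈ wbSet S, ∀ n, eps n s ≤ eps (n + 1) s
  U3_wb : ∀ s ∈ wbSet S, ∀ n, WayBelow (eps n s) s
  U3_sup : ∀ s ∈ wbSet S, IsLUB (Set.range fun n => eps n s) s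
  U4 : ∀ l, ∀ s ∈ M l, ∀ n, l < n → WayBelow (eps n s) (eps (n + 1) s)

/-- Strict comparison `α ≈_Λ β` of two maps on a subset `Λ`. -/
def ApproxOn {S T : Type*} [Preorder S] [Preorder T] (α β : S → T) (Λ : Set S) : Prop :=
  ∀ g' ∈ Λ, ∀ g ∈ Λ, WayBelow g' g → WayBelow (α g') (β g) ∧ WayBelow (β g') (α g)

/-- Comparison `α ≃_Λ β` of two maps on a subset `Λ`. -/
def CompareOn {S T : Type*} [Preorder S] [Preorder T] (α β : S → T) (Λ : Set S) : Prop :=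
  ∀ g' ∈ Λ, ∀ g ∈ Λ, WayBelow g' g → α g' ≤ β g ∧ β g' ≤ α g

theorem wb_le {S : Type*} [Preorder S] {x y : S} (h : WayBelow x y) : x ≤ y := by
  obtain ⟨_, hk⟩ := h (fun _ => y) monotone_const y (by simp) le_rfl
  exact hk

theorem wb_trans_le {S : Type*} [Preorder S] {x y z : S} (h : WayBelow x y) (h' : y ≤ z) :
    WayBelow x z := fun u hu w hw hz => h u hu w hw (h'.trans hz)

theorem M_mono {S : Type*} [AddCommMonoid S] [PartialOrder S] [IsOrderedAddMonoid S]
    (U : UniformBasis S) : Monotone U.M := monotone_nat_of_le_succ U.U1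

theorem lub_tail {S : Type*} [PartialOrder S] {f : ℕ → S} {m N : ℕ} {w : S}
    (hmono : ∀ j, m < j → f j ≤ f (j + 1)) (hN : m < N) :
    IsLUB (f '' {j | m < j}) w ↔ IsLUB (Set.range fun k => f (k + N)) w := by
  have hle : ∀ j, m < j → ∀ k, f j ≤ f (j + k) := by
    intro j hj k
    induction k with
    | zero => exact le_rfl
    | succ k ih => exact ih.trans (hmono (j + k) (by omega))
  have : upperBounds (f '' {j | m < j}) = upperBounds (Set.range fun k => f (k + N)) := by
    ext u
    constructor
    · rintro h _ ⟨k, rfl⟩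
      exact h ⟨k + N, by simp only [Set.mem_setOf_eq]; omega, rfl⟩
    · rintro h _ ⟨j, hj, rfl⟩
      exact (hle j hj N).trans (h ⟨j, rfl⟩)
  unfold IsLUB
  rw [this]

/-- One-sided approximate intertwining: the sequence defining `γ_i` is `≪`-increasing and
`γ_i` is a PoM-morphism on `∪_l M_l`. -/
theorem one_sided_intertwining_gamma
    {S T : ℕ → Type*} [∀ i, AddCommMonoid (S i)] [∀ i, PartialOrder (S i)] [∀ i, IsOrderedAddMonoid (S i)]
    [∀ i, AddCommMonoid (T i)] [∀ i, PartialOrder (T i)] [∀ i, IsOrderedAddMonoid (T i)]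
    (hS : ∀ i, IsCu (S i)) (hT : ∀ i, IsCu (T i))
    (σ : ∀ i j : ℕ, S i → S j) (τ : ∀ i j : ℕ, T i → T j)
    (hσid : ∀ i x, σ i i x = x) (hτid : ∀ i x, τ i i x = x)
    (hσcomp : ∀ i j k : ℕ, i ≤ j → j ≤ k → ∀ x, σ j k (σ i j x) = σ i k x)
    (hτcomp : ∀ i j k : ℕ, i ≤ j → j ≤ k → ∀ x, τ j k (τ i j x) = τ i k x)
    (hσcu : ∀ i j : ℕ, i ≤ j → IsCuMorphism (σ i j))
    (hτcu : ∀ i j : ℕ, i ≤ j → IsCuMorphism (τ i j))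
    {SL TL : Type*} [AddCommMonoid SL] [PartialOrder SL] [IsOrderedAddMonoid SL]
    [AddCommMonoid TL] [PartialOrder TL] [IsOrderedAddMonoid TL]
    (hSL : IsCu SL) (hTL : IsCu TL)
    (σinf : ∀ i, S i → SL) (τinf : ∀ i, T i → TL)
    (hσinfcu : ∀ i, IsCuMorphism (σinf i)) (hτinfcu : ∀ i, IsCuMorphism (τinf i))
    (hσinfcomp : ∀ i j : ℕ, i ≤ j → ∀ x, σinf j (σ i j x) = σinf i x)
    (hτinfcomp : ∀ i j : ℕ, i ≤ j → ∀ x, τinf j (τ i j x) = τinf i x)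
    (hL1S : ∀ s : SL, ∃ sf : ∀ i, S i, (∀ i, WayBelow (σ i (i + 1) (sf i)) (sf (i + 1))) ∧
      IsLUB (Set.range fun i => σinf i (sf i)) s)
    (hL1T : ∀ t : TL, ∃ tf : ∀ i, T i, (∀ i, WayBelow (τ i (i + 1) (tf i)) (tf (i + 1))) ∧
      IsLUB (Set.range fun i => τinf i (tf i)) t)
    (hL2S : ∀ (i : ℕ) (s t : S i), σinf i s ≤ σinf i t → ∀ s', WayBelow s' s →
      ∃ j, i ≤ j ∧ WayBelow (σ i j s') (σ i j t))
    (hL2T : ∀ (i : ℕ) (s t : T i), τinf i s ≤ τinf i t → ∀ s', WayBelow s' s →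
      ∃ j, i ≤ j ∧ WayBelow (τ i j s') (τ i j t))
    (US : ∀ i, UniformBasis (S i)) (UT : ∀ i, UniformBasis (T i))
    (c : ∀ i, S i → T i) (hc : ∀ i, IsCuMorphism (c i))
    (nseq : ℕ → ℕ) (hn : StrictMono nseq)
    -- (i)
    (hMS : ∀ i j : ℕ, i ≤ j → ∀ x ∈ (US i).M (nseq j), σ i j x ∈ (US j).M (nseq j))
    -- (ii)
    (hint : ∀ i, ApproxOn (fun x => c (i + 1) (σ i (i + 1) x)) (fun x => τ i (i + 1) (c i x))
      ((US i).M (nseq i))) :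
    ∀ i : ℕ,
      (∀ s ∈ ⋃ l, (US i).M l, ∀ j : ℕ, max i (sInf {l | s ∈ (US i).M l}) < j →
        WayBelow (τinf (j + 1) (c (j + 1) (σ i (j + 1) ((US i).eps (nseq j) s))))
          (τinf (j + 2) (c (j + 2) (σ i (j + 2) ((US i).eps (nseq (j + 1)) s))))) ∧
      ∃ γ : S i → TL,
        (∀ s ∈ ⋃ l, (US i).M l,
          IsLUB ((fun j : ℕ => τinf (j + 1) (c (j + 1) (σ i (j + 1) ((US i).eps (nseq j) s)))) ''
            {j : ℕ | max i (sInf {l | s ∈ (US i).M l}) < j}) (γ s)) ∧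
        γ 0 = 0 ∧
        (∀ s ∈ ⋃ l, (US i).M l, ∀ t ∈ ⋃ l, (US i).M l, γ (s + t) = γ s + γ t) ∧
        (∀ s ∈ ⋃ l, (US i).M l, ∀ t ∈ ⋃ l, (US i).M l, s ≤ t → γ s ≤ γ t) := by
  intro i
  have hwb : ∀ s ∈ ⋃ l, (US i).M l, s ∈ wbSet (S i) := by
    intro s hs
    obtain ⟨l, hl⟩ := Set.mem_iUnion.1 hs
    exact (US i).M_subset l hl
  have hmin : ∀ s ∈ ⋃ l, (US i).M l, s ∈ (US i).M (sInf {l | s ∈ (US i).M l}) := by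
    intro s hs
    obtain ⟨l, hl⟩ := Set.mem_iUnion.1 hs
    exact Nat.sInf_mem (s := {l | s ∈ (US i).M l}) ⟨l, hl⟩
  have hinc : ∀ s ∈ ⋃ l, (US i).M l, ∀ j : ℕ, max i (sInf {l | s ∈ (US i).M l}) < j →
        WayBelow (τinf (j + 1) (c (j + 1) (σ i (j + 1) ((US i).eps (nseq j) s))))
          (τinf (j + 2) (c (j + 2) (σ i (j + 2) ((US i).eps (nseq (j + 1)) s)))) := by
    intro s hs j hj
    have hij : i ≤ j := by omega
    have hjn := hn.le_apply (x := j)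
    have hlt : nseq j + 1 ≤ nseq (j + 1) := hn (Nat.lt_succ_self j)
    have hem : Monotone fun n => (US i).eps n s :=
      monotone_nat_of_le_succ ((US i).U3_mono s (hwb s hs))
    have hab : WayBelow ((US i).eps (nseq j) s) ((US i).eps (nseq (j + 1)) s) :=
      wb_trans_le ((US i).U4 _ s (hmin s hs) (nseq j) (by omega)) (hem hlt)
    have hb := (US i).eps_mem (nseq (j + 1)) s (hwb s hs)
    have ha := M_mono (US i) (by omega : nseq j ≤ nseq (j + 1))
      ((US i).eps_mem (nseq j) s (hwb s hs))
    have h := (hint (j + 1) _ (hMS i (j + 1) (by omega) _ ha) _ (hMS i (j + 1) (by omega) _ hb)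
      ((hσcu i (j + 1) (by omega)).map_wayBelow _ _ hab)).2
    have h2 := (hτinfcu (j + 1 + 1)).map_wayBelow _ _ h
    simp only [hτinfcomp (j + 1) (j + 1 + 1) (by omega),
      hσcomp i (j + 1) (j + 1 + 1) (by omega) (by omega)] at h2
    exact h2
  refine ⟨hinc, ?_⟩
  let F : S i → ℕ → TL := fun s j =>
    τinf (j + 1) (c (j + 1) (σ i (j + 1) ((US i).eps (nseq j) s)))
  have hFle : ∀ s ∈ ⋃ l, (US i).M l, ∀ j : ℕ, max i (sInf {l | s ∈ (US i).M l}) < j →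
      F s j ≤ F s (j + 1) := fun s hs j hj => wb_le (hinc s hs j hj)
  have hFmono : ∀ s ∈ ⋃ l, (US i).M l, ∀ N : ℕ, max i (sInf {l | s ∈ (US i).M l}) < N →
      Monotone fun k => F s (k + N) := by
    intro s hs N hN
    refine monotone_nat_of_le_succ fun k => ?_
    have := hFle s hs (k + N) (by omega)
    rwa [show k + N + 1 = k + 1 + N by omega] at this
  have hex : ∀ s, ∃ w, s ∈ (⋃ l, (US i).M l) →
      IsLUB (F s '' {j : ℕ | max i (sInf {l | s ∈ (US i).M l}) < j}) w := by
    intro s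
    by_cases hs : s ∈ ⋃ l, (US i).M l
    · obtain ⟨w, hw⟩ := hTL.O1 _ (hFmono s hs _ (Nat.lt_succ_self _))
      exact ⟨w, fun _ => (lub_tail (hFle s hs) (Nat.lt_succ_self _)).2 hw⟩
    · exact ⟨0, fun h => absurd h hs⟩
  choose γ hγ using hex
  have hγt : ∀ s ∈ ⋃ l, (US i).M l, ∀ N : ℕ, max i (sInf {l | s ∈ (US i).M l}) < N →
      IsLUB (Set.range fun k => F s (k + N)) (γ s) :=
    fun s hs N hN => (lub_tail (hFle s hs) hN).1 (hγ s hs)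
  have h0 : (0 : S i) ∈ ⋃ l, (US i).M l := Set.mem_iUnion.2 ⟨0, (US i).zero_mem 0⟩
  refine ⟨γ, hγ, ?_, ?_, ?_⟩
  · have h := hγt 0 h0 _ (Nat.lt_succ_self _)
    have hF0 : ∀ k, i ≤ k → F 0 k = 0 := by
      intro k hk
      have : (US i).eps (nseq k) 0 = 0 :=
        le_antisymm (wb_le ((US i).U3_wb 0 (hwb 0 h0) _)) ((hS i).zero_le _)
      simp only [F, this, (hσcu i (k + 1) (by omega)).map_zero, (hc (k + 1)).map_zero,
        (hτinfcu (k + 1)).map_zero]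
    refine le_antisymm (h.2 ?_) (hTL.zero_le _)
    rintro _ ⟨k, rfl⟩
    exact (hF0 _ (by omega)).le
  · intro s hs t ht
    have hst : s + t ∈ ⋃ l, (US i).M l := Set.mem_iUnion.2
      ⟨max (sInf {l | s ∈ (US i).M l}) (sInf {l | t ∈ (US i).M l}),
        (US i).add_mem _ _ (M_mono (US i) (le_max_left _ _) (hmin s hs)) _
          (M_mono (US i) (le_max_right _ _) (hmin t ht))⟩
    obtain ⟨N, hN1, hN2, hN3⟩ : ∃ N, max i (sInf {l | s ∈ (US i).M l}) + 1 < N ∧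
        max i (sInf {l | t ∈ (US i).M l}) + 1 < N ∧
        max i (sInf {l | s + t ∈ (US i).M l}) + 1 < N :=
      ⟨max i (sInf {l | s ∈ (US i).M l}) + max i (sInf {l | t ∈ (US i).M l}) +
        max i (sInf {l | s + t ∈ (US i).M l}) + 2, by omega, by omega, by omega⟩
    have hadd : (fun k => F (s + t) (k + N)) = fun k => F s (k + N) + F t (k + N) := by
      funext k
      have hk := hn.le_apply (x := k + N)
      have he := (US i).U2 (nseq (k + N)) s t ⟨_, by omega, hmin s hs⟩ ⟨_, by omega, hmin t ht⟩
      simp only [F, he, (hσcu i (k + N + 1) (by omega)).map_add, (hc (k + N + 1)).map_add,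
        (hτinfcu (k + N + 1)).map_add]
    have h1 := hγt (s + t) hst N (by omega)
    rw [hadd] at h1
    exact h1.unique (hTL.O4 _ _ (hFmono s hs N (by omega)) (hFmono t ht N (by omega)) _ _
      (hγt s hs N (by omega)) (hγt t ht N (by omega)))
  · intro s hs t ht hle
    obtain ⟨N, hN1, hN2⟩ : ∃ N, max i (sInf {l | s ∈ (US i).M l}) < N ∧
        max i (sInf {l | t ∈ (US i).M l}) < N :=
      ⟨max i (sInf {l | s ∈ (US i).M l}) + max i (sInf {l | t ∈ (US i).M l}) + 1,
        by omega, by omega⟩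
    refine (hγt s hs N hN1).2 ?_
    rintro _ ⟨k, rfl⟩
    refine le_trans ?_ ((hγt t ht N hN2).1 ⟨k, rfl⟩)
    exact (hτinfcu _).mono ((hc _).mono ((hσcu i (k + N + 1) (by omega)).mono
      ((US i).eps_mono _ s (hwb s hs) t (hwb t ht) hle)))
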